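/- Second Lamé pair: let λ, μ be real with μ ≠ 0, γ = (λ+μ)/μ ≠ 0, let D ⊆ ℝ² be open, and let U₁, U₂, U₃, U₄ : D → ℝ be twice continuously differentiable functions satisfying the Cauchy–Riemann-type system (CR) on D. Define u = −((2+γ)/γ)·U₂ − (2(1+γ)/γ)·U₃ and v = U₄, and θ = ∂u/∂x + ∂v/∂y. Then (u, v) solves the Lamé equilibrium system in D: Δu + γ·∂θ/∂x = 0 and Δv + γ·∂θ/∂y = 0. -/

import Mathlib

/- Lamé equilibrium pairs built from the components of a monogenic 𝔹-valued
   function (Theorem 1 of [Gr-dop-15]). -/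

noncomputable section

/-- The partial derivative in `x` of a function `ℝ² → ℝ`. -/
def pdx (f : ℝ × ℝ → ℝ) : ℝ × ℝ → ℝ := fun p => fderiv ℝ f p (1, 0)

/-- The partial derivative in `y` of a function `ℝ² → ℝ`. -/
def pdy (f : ℝ × ℝ → ℝ) : ℝ × ℝ → ℝ := fun p => fderiv ℝ f p (0, 1)

/-- The Cauchy–Riemann-type system for the components `U₁, U₂, U₃, U₄`. -/
def CRsys (U₁ U₂ U₃ U₄ : ℝ × ℝ → ℝ) (p : ℝ × ℝ) : Prop :=
  pdy U₁ p = pdx U₃ p ∧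
  pdy U₂ p = pdx U₄ p ∧
  pdy U₃ p = pdx U₁ p - 2 * pdx U₄ p ∧
  pdy U₄ p = pdx U₂ p + 2 * pdx U₃ p

theorem pdx_congr {f g : ℝ × ℝ → ℝ} {D : Set (ℝ × ℝ)} (hD : IsOpen D)
    (h : ∀ q ∈ D, f q = g q) {p : ℝ × ℝ} (hp : p ∈ D) : pdx f p = pdx g p := by
  have h' : f =ᶠ[nhds p] g := Filter.eventuallyEq_of_mem (hD.mem_nhds hp) h
  simp only [pdx, h'.fderiv_eq]

theorem pdy_congr {f g : ℝ × ℝ → ℝ} {D : Set (ℝ × ℝ)} (hD : IsOpen D)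
    (h : ∀ q ∈ D, f q = g q) {p : ℝ × ℝ} (hp : p ∈ D) : pdy f p = pdy g p := by
  have h' : f =ᶠ[nhds p] g := Filter.eventuallyEq_of_mem (hD.mem_nhds hp) h
  simp only [pdy, h'.fderiv_eq]

theorem fderiv_linear_combination {f g : ℝ × ℝ → ℝ} {p : ℝ × ℝ} (a b : ℝ)
    (hf : DifferentiableAt ℝ f p) (hg : DifferentiableAt ℝ g p) :
    fderiv ℝ (fun q => a * f q + b * g q) p = a • fderiv ℝ f p + b • fderiv ℝ g p :=
  ((hf.hasFDerivAt.const_mul a).add (hg.hasFDerivAt.const_mul b)).fderiv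

theorem pdx_linear_combination {f g : ℝ × ℝ → ℝ} {p : ℝ × ℝ} (a b : ℝ)
    (hf : DifferentiableAt ℝ f p) (hg : DifferentiableAt ℝ g p) :
    pdx (fun q => a * f q + b * g q) p = a * pdx f p + b * pdx g p := by
  simp [pdx, fderiv_linear_combination a b hf hg]

theorem pdy_linear_combination {f g : ℝ × ℝ → ℝ} {p : ℝ × ℝ} (a b : ℝ)
    (hf : DifferentiableAt ℝ f p) (hg : DifferentiableAt ℝ g p) :
    pdy (fun q => a * f q + b * g q) p = a * pdy f p + b * pdy g p := by
  simp [pdy, fderiv_linear_combination a b hf hg]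

theorem ContDiffAt.differentiableAt_fderiv {f : ℝ × ℝ → ℝ} {p : ℝ × ℝ}
    (hf : ContDiffAt ℝ 2 f p) : DifferentiableAt ℝ (fderiv ℝ f) p :=
  (hf.fderiv_right (m := 1) (by norm_num)).differentiableAt (by norm_num)

theorem ContDiffAt.differentiableAt_pdx {f : ℝ × ℝ → ℝ} {p : ℝ × ℝ}
    (hf : ContDiffAt ℝ 2 f p) : DifferentiableAt ℝ (pdx f) p :=
  hf.differentiableAt_fderiv.clm_apply (differentiableAt_const _)

/-- Equality of the mixed second partial derivatives. -/
theorem ContDiffAt.pdy_pdx {f : ℝ × ℝ → ℝ} {p : ℝ × ℝ}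
    (hf : ContDiffAt ℝ 2 f p) : pdy (pdx f) p = pdx (pdy f) p := by
  have hd := hf.differentiableAt_fderiv
  have key (e : ℝ × ℝ) : fderiv ℝ (fun q => fderiv ℝ f q e) p =
      (fderiv ℝ (fderiv ℝ f) p).flip e := by
    rw [fderiv_clm_apply hd (differentiableAt_const e)]
    simp
  have hs : IsSymmSndFDerivAt ℝ f p := hf.isSymmSndFDerivAt (by simp)
  change fderiv ℝ (fun q => fderiv ℝ f q (1, 0)) p (0, 1) =
    fderiv ℝ (fun q => fderiv ℝ f q (0, 1)) p (1, 0)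
  rw [key, key]
  exact hs _ _

/-- Second Lamé pair: with `γ = (λ+μ)/μ ≠ 0`, the pair
`u = −((2+γ)/γ)U₂ − (2(1+γ)/γ)U₃`, `v = U₄` built from C² components of a monogenic
function satisfies the Lamé equilibrium system
`Δu + γθₓ = 0`, `Δv + γθ_y = 0`, where `θ = uₓ + v_y`. -/
theorem second_Lame_pair (lam μ : ℝ) (hμ : μ ≠ 0)
    (γ : ℝ) (hγdef : γ = (lam + μ) / μ) (hγ : γ ≠ 0)
    (D : Set (ℝ × ℝ)) (hD : IsOpen D)
    (U₁ U₂ U₃ U₄ : ℝ × ℝ → ℝ)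
    (h₁ : ContDiffOn ℝ 2 U₁ D) (h₂ : ContDiffOn ℝ 2 U₂ D)
    (h₃ : ContDiffOn ℝ 2 U₃ D) (h₄ : ContDiffOn ℝ 2 U₄ D)
    (hCR : ∀ p ∈ D, CRsys U₁ U₂ U₃ U₄ p)
    (u v θ : ℝ × ℝ → ℝ)
    (hu : u = fun p => -((2 + γ) / γ) * U₂ p - (2 * (1 + γ) / γ) * U₃ p)
    (hv : v = U₄)
    (hθ : θ = fun p => pdx u p + pdy v p) :
    ∀ p ∈ D,
      pdx (pdx u) p + pdy (pdy u) p + γ * pdx θ p = 0 ∧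
      pdx (pdx v) p + pdy (pdy v) p + γ * pdy θ p = 0 := by
  have C {f : ℝ × ℝ → ℝ} (hf : ContDiffOn ℝ 2 f D) {q : ℝ × ℝ} (hq : q ∈ D) :
      ContDiffAt ℝ 2 f q := hf.contDiffAt (hD.mem_nhds hq)
  have d {f : ℝ × ℝ → ℝ} (hf : ContDiffOn ℝ 2 f D) {q : ℝ × ℝ} (hq : q ∈ D) :
      DifferentiableAt ℝ f q := (C hf hq).differentiableAt (by norm_num)
  have dx {f : ℝ × ℝ → ℝ} (hf : ContDiffOn ℝ 2 f D) {q : ℝ × ℝ} (hq : q ∈ D) :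
      DifferentiableAt ℝ (pdx f) q := (C hf hq).differentiableAt_pdx
  set A := -((2 + γ) / γ) with hA
  set B := -(2 * (1 + γ) / γ) with hB
  have hu' : u = fun p => A * U₂ p + B * U₃ p := by
    rw [hu]; funext q; rw [hB]; ring
  have hAB : A - B = 1 := by rw [hA, hB]; field_simp; ring
  have hA1 : γ * (A + 1) = -2 := by rw [hA]; field_simp; ring
  have ux : ∀ q ∈ D, pdx u q = A * pdx U₂ q + B * pdx U₃ q := fun q hq => by
    rw [hu', pdx_linear_combination A B (d h₂ hq) (d h₃ hq)]
  have uy : ∀ q ∈ D, pdy u q = B * pdx U₁ q + (A - 2 * B) * pdx U₄ q := fun q hq => by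
    obtain ⟨-, c₂, c₃, -⟩ := hCR q hq
    rw [hu', pdy_linear_combination A B (d h₂ hq) (d h₃ hq), c₂, c₃]; ring
  have vy : ∀ q ∈ D, pdy U₄ q = 1 * pdx U₂ q + 2 * pdx U₃ q := fun q hq => by
    rw [(hCR q hq).2.2.2, one_mul]
  have ht : ∀ q ∈ D, θ q = (A + 1) * pdx U₂ q + (A + 1) * pdx U₃ q := fun q hq => by
    rw [hθ, hv]
    simp only [ux q hq, vy q hq]
    linear_combination (-pdx U₃ q) * hAB
  intro p hp
  have e₁ : pdy (pdx U₁) p = pdx (pdx U₃) p := by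
    rw [(C h₁ hp).pdy_pdx, pdx_congr hD (fun q hq => (hCR q hq).1) hp]
  have e₂ : pdy (pdx U₂) p = pdx (pdx U₄) p := by
    rw [(C h₂ hp).pdy_pdx, pdx_congr hD (fun q hq => (hCR q hq).2.1) hp]
  have e₃ : pdy (pdx U₃) p = pdx (pdx U₁) p - 2 * pdx (pdx U₄) p := by
    have h : ∀ q ∈ D, pdy U₃ q = 1 * pdx U₁ q + (-2) * pdx U₄ q := fun q hq => by
      rw [(hCR q hq).2.2.1]; ring
    rw [(C h₃ hp).pdy_pdx, pdx_congr hD h hp,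
      pdx_linear_combination _ _ (dx h₁ hp) (dx h₄ hp)]
    ring
  have e₄ : pdy (pdx U₄) p = pdx (pdx U₂) p + 2 * pdx (pdx U₃) p := by
    rw [(C h₄ hp).pdy_pdx, pdx_congr hD vy hp,
      pdx_linear_combination _ _ (dx h₂ hp) (dx h₃ hp)]
    ring
  constructor
  · rw [pdx_congr hD ux hp, pdy_congr hD uy hp, pdx_congr hD ht hp,
      pdx_linear_combination _ _ (dx h₂ hp) (dx h₃ hp),
      pdy_linear_combination _ _ (dx h₁ hp) (dx h₄ hp),
      pdx_linear_combination _ _ (dx h₂ hp) (dx h₃ hp), e₁, e₄]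
    linear_combination (pdx (pdx U₂) p + pdx (pdx U₃) p) * (2 * hAB + hA1)
  · rw [hv, pdy_congr hD vy hp, pdy_congr hD ht hp,
      pdy_linear_combination _ _ (dx h₂ hp) (dx h₃ hp),
      pdy_linear_combination _ _ (dx h₂ hp) (dx h₃ hp), e₂, e₃]
    linear_combination (pdx (pdx U₁) p - pdx (pdx U₄) p) * hA1
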